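/- arXiv:2002.07430 — 2 statements merged into one kernel-verified Lean document; each statement's English description precedes it below -/
import Mathlib

section
/- Let μ, ν be real with μ > −3 and |ν| < μ+3, and let Δ_{μ,ν}(x) = (t̃_{μ,ν}(x))² − t̃_{μ−1,ν−1}(x) t̃_{μ+1,ν+1}(x). Then for all x > 0, 0 < 2(x/2)^{2μ+2} / ((μ+ν+3)(Γ((μ−ν+3)/2) Γ((μ+ν+3)/2))²) ≤ Δ_{μ,ν}(x) ≤ 2(t̃_{μ,ν}(x))² / (μ+ν+3). -/
open Real

/-- Normalized modified Lommel function of the first kind. -/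
noncomputable def modLommel (μ ν x : ℝ) : ℝ :=
  ∑' k : ℕ, (x / 2) ^ (μ + 2 * (k : ℝ) + 1) /
    (Gamma ((k : ℝ) + (μ - ν + 3) / 2) * Gamma ((k : ℝ) + (μ + ν + 3) / 2))

open Finset in
/-- A sum over an antidiagonal is nonnegative if its summand has nonnegative symmetrization. -/
lemma sum_antidiagonal_nonneg_of_add_swap_nonneg (n : ℕ) (f : ℕ → ℕ → ℝ)
    (hf : ∀ i j, 0 ≤ f i j + f j i) : 0 ≤ ∑ p ∈ antidiagonal n, f p.1 p.2 := by
  have hswap : ∑ p ∈ antidiagonal n, f p.2 p.1 = ∑ p ∈ antidiagonal n, f p.1 p.2 :=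
    Nat.sum_antidiagonal_swap (f := fun p => f p.1 p.2)
  have hsum : 0 ≤ ∑ p ∈ antidiagonal n, (f p.1 p.2 + f p.2 p.1) :=
    sum_nonneg fun p _ => hf p.1 p.2
  rw [sum_add_distrib, hswap] at hsum
  linarith

section TwoParameterSeries

variable {a b z : ℝ} {A B : ℕ → ℝ}

lemma summable_pow_mul_mul (ha : 0 < a) (hb : 0 < b) (hz : 0 < z)
    (hA : ∀ k, 0 < A k) (hB : ∀ k, 0 < B k)
    (hA' : ∀ k : ℕ, A k = (k + a) * A (k + 1)) (hB' : ∀ k : ℕ, B k = (k + b) * B (k + 1)) :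
    Summable fun k => z ^ k * A k * B k := by
  refine summable_of_ratio_test_tendsto_lt_one (l := 0) one_pos
    (.of_forall fun k => (mul_pos (mul_pos (pow_pos hz k) (hA k)) (hB k)).ne') ?_
  have hratio : ∀ k : ℕ, ‖z ^ (k + 1) * A (k + 1) * B (k + 1)‖ / ‖z ^ k * A k * B k‖ =
      z * ((k + a)⁻¹ * (k + b)⁻¹) := by
    intro k
    have h₁ := hA (k + 1)
    have h₂ := hB (k + 1)
    rw [hA' k, hB' k, Real.norm_of_nonneg (by positivity), Real.norm_of_nonneg (by positivity)]
    field_simp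
    ring
  simp_rw [hratio]
  have hinv (c : ℝ) : Filter.Tendsto (fun k : ℕ => ((k : ℝ) + c)⁻¹) Filter.atTop (nhds 0) :=
    tendsto_inv_atTop_zero.comp
      (Filter.tendsto_atTop_add_const_right _ c tendsto_natCast_atTop_atTop)
  simpa using ((hinv a).mul (hinv b)).const_mul z

lemma summable_shift_mul_pow_mul_mul (ha : 0 < a) (hb : 0 < b) (hz : 0 < z)
    (hA : ∀ k, 0 < A k) (hB : ∀ k, 0 < B k)
    (hA' : ∀ k : ℕ, A k = (k + a) * A (k + 1)) (hB' : ∀ k : ℕ, B k = (k + b) * B (k + 1)) :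
    Summable fun k : ℕ => (k + b - 1) * (z ^ k * A k * B k) := by
  rw [← summable_nat_add_iff 1]
  refine Summable.of_nonneg_of_le (fun k => ?_) (fun k => ?_)
    ((summable_pow_mul_mul ha hb hz hA hB hA' hB').mul_left (z / a))
  · have h₁ := hA (k + 1)
    have h₂ := hB (k + 1)
    have h₃ : (0 : ℝ) ≤ (k + 1 : ℕ) + b - 1 := by push_cast; linarith [k.cast_nonneg (α := ℝ)]
    positivity
  · have h₁ := hA (k + 1)
    have h₂ := hB k
    calc ((k + 1 : ℕ) + b - 1) * (z ^ (k + 1) * A (k + 1) * B (k + 1))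
        = z / a * (z ^ k * (a * A (k + 1)) * ((k + b) * B (k + 1))) := by
          push_cast; field_simp; ring
      _ = z / a * (z ^ k * (a * A (k + 1)) * B k) := by rw [← hB' k]
      _ ≤ z / a * (z ^ k * A k * B k) := by
          rw [hA' k]
          gcongr
          linarith [k.cast_nonneg (α := ℝ)]

open Finset in
lemma sum_antidiagonal_turan_nonneg (hz : 0 < z) (hb : 0 < b)
    (hA : ∀ k, 0 < A k) (hB : ∀ k, 0 < B k)
    (hA' : ∀ k : ℕ, A k = (k + a) * A (k + 1)) (hB' : ∀ k : ℕ, B k = (k + b) * B (k + 1))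
    (n : ℕ) :
    0 ≤ ∑ p ∈ antidiagonal n, ((z ^ p.1 * A p.1 * B p.1) * (z ^ p.2 * A p.2 * B p.2) -
      ((p.1 + b - 1) * (z ^ p.1 * A p.1 * B p.1)) *
        ((z ^ p.2 * A p.2 * B p.2) / (p.2 + b))) := by
  have hterm : ∀ p ∈ antidiagonal n,
      (z ^ p.1 * A p.1 * B p.1) * (z ^ p.2 * A p.2 * B p.2) -
        ((p.1 + b - 1) * (z ^ p.1 * A p.1 * B p.1)) *
          ((z ^ p.2 * A p.2 * B p.2) / (p.2 + b)) =
      z ^ n * (((p.2 : ℝ) + 1 - p.1) * (A p.1 * A p.2 * B p.1 * B (p.2 + 1))) := by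
    intro p hp
    have hpos : (0 : ℝ) < p.2 + b := by positivity
    rw [← mem_antidiagonal.mp hp, pow_add, hB' p.2]
    field_simp
    ring
  rw [sum_congr rfl hterm, ← mul_sum]
  refine mul_nonneg (by positivity) ?_
  cases n with
  | zero =>
    have := hA 0
    have := hB 0
    have := hB 1
    simp only [Nat.antidiagonal_zero, sum_singleton, CharP.cast_eq_zero, zero_add, sub_zero, one_mul]
    positivity
  | succ m =>
    rw [Nat.sum_antidiagonal_succ]
    refine add_nonneg ?_ ?_
    · have := hA 0
      have := hA (m + 1)
      have := hB 0
      have := hB (m + 1 + 1)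
      simp only [CharP.cast_eq_zero, sub_zero]
      positivity
    · refine sum_antidiagonal_nonneg_of_add_swap_nonneg m (fun i j =>
        ((j : ℝ) + 1 - (i + 1 : ℕ)) * (A (i + 1) * A j * B (i + 1) * B (j + 1))) fun i j => ?_
      have h₁ := hA (i + 1)
      have h₂ := hA (j + 1)
      have h₃ := hB (i + 1)
      have h₄ := hB (j + 1)
      have hsq : ((j : ℝ) + 1 - (i + 1 : ℕ)) * (A (i + 1) * A j * B (i + 1) * B (j + 1)) +
          ((i : ℝ) + 1 - (j + 1 : ℕ)) * (A (j + 1) * A i * B (j + 1) * B (i + 1)) =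
          ((j : ℝ) - i) ^ 2 * (A (i + 1) * A (j + 1) * B (i + 1) * B (j + 1)) := by
        rw [hA' i, hA' j]
        push_cast
        ring
      simp only [hsq]
      positivity

open Finset in
lemma sum_antidiagonal_turan_le (hb : 0 < b) {c : ℕ → ℝ} (hc : ∀ k, 0 < c k) (n : ℕ) :
    ∑ p ∈ antidiagonal n, (c p.1 * c p.2 - ((p.1 + b - 1) * c p.1) * (c p.2 / (p.2 + b))) ≤
      ∑ p ∈ antidiagonal n, c p.1 * c p.2 / b := by
  rw [← sub_nonneg, ← sum_sub_distrib]
  refine sum_antidiagonal_nonneg_of_add_swap_nonneg n (fun i j =>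
    c i * c j / b - (c i * c j - ((i + b - 1) * c i) * (c j / (j + b)))) fun i j => ?_
  have h₁ := hc i
  have h₂ := hc j
  have hsq : c i * c j / b - (c i * c j - ((i + b - 1) * c i) * (c j / (j + b))) +
      (c j * c i / b - (c j * c i - ((j + b - 1) * c j) * (c i / (i + b)))) =
      c i * c j * (b * ((i : ℝ) - j) ^ 2 + (i + b) * j + (j + b) * i) /
        (b * (i + b) * (j + b)) := by
    have : (0 : ℝ) < i + b := by positivity
    have : (0 : ℝ) < j + b := by positivity
    field_simp
    ring
  simp only [hsq]
  positivity

open Finset in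
/-- Turán-type bounds for the series whose coefficients behave like `1 / (Γ (k + a) Γ (k + b))`,
under unit shifts of the parameter `b`. -/
theorem turan_bounds (ha : 0 < a) (hb : 0 < b) (hz : 0 < z)
    (hA : ∀ k, 0 < A k) (hB : ∀ k, 0 < B k)
    (hA' : ∀ k : ℕ, A k = (k + a) * A (k + 1)) (hB' : ∀ k : ℕ, B k = (k + b) * B (k + 1)) :
    (A 0 * B 0) ^ 2 / b ≤ (∑' k, z ^ k * A k * B k) ^ 2 -
        (∑' k : ℕ, (k + b - 1) * (z ^ k * A k * B k)) *
          (∑' k : ℕ, (z ^ k * A k * B k) / (k + b)) ∧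
      (∑' k, z ^ k * A k * B k) ^ 2 -
        (∑' k : ℕ, (k + b - 1) * (z ^ k * A k * B k)) *
          (∑' k : ℕ, (z ^ k * A k * B k) / (k + b)) ≤
        (∑' k, z ^ k * A k * B k) ^ 2 / b := by
  have hpos : ∀ k, 0 < z ^ k * A k * B k := fun k =>
    mul_pos (mul_pos (pow_pos hz k) (hA k)) (hB k)
  have hsum := summable_pow_mul_mul ha hb hz hA hB hA' hB'
  have hsum_up := summable_shift_mul_pow_mul_mul ha hb hz hA hB hA' hB'
  have hsum_down : Summable fun k : ℕ => (z ^ k * A k * B k) / (k + b) := by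
    refine Summable.of_nonneg_of_le (fun k => ?_) (fun k => ?_) (hsum.div_const b)
    · have := hpos k
      positivity
    · exact div_le_div_of_nonneg_left (hpos k).le hb (by linarith [k.cast_nonneg (α := ℝ)])
  have hsq := summable_sum_mul_antidiagonal_of_summable_norm' hsum.norm hsum hsum.norm hsum
  have hmul := summable_sum_mul_antidiagonal_of_summable_norm' hsum_up.norm hsum_up
    hsum_down.norm hsum_down
  rw [sq (∑' k, z ^ k * A k * B k),
    tsum_mul_tsum_eq_tsum_sum_antidiagonal_of_summable_norm hsum.norm hsum.norm,
    tsum_mul_tsum_eq_tsum_sum_antidiagonal_of_summable_norm hsum_up.norm hsum_down.norm,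
    ← hsq.tsum_sub hmul, ← tsum_div_const]
  simp_rw [← sum_sub_distrib, sum_div]
  have hdiff := hsq.sub hmul
  simp_rw [← sum_sub_distrib] at hdiff
  have hsq_div := hsq.div_const b
  simp_rw [sum_div] at hsq_div
  constructor
  · refine le_trans (le_of_eq ?_) (hdiff.le_tsum 0 fun n _ =>
      sum_antidiagonal_turan_nonneg hz hb hA hB hA' hB' n)
    simp only [Nat.antidiagonal_zero, sum_singleton, CharP.cast_eq_zero, zero_add, pow_zero, one_mul]
    field_simp
    ring
  · exact hdiff.tsum_le_tsum (fun n => sum_antidiagonal_turan_le hb hpos n) hsq_div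

end TwoParameterSeries

/-- Also valid at the pole `s = 0`, where both sides vanish. -/
lemma inv_Gamma_eq_mul_inv_Gamma_add_one (s : ℝ) :
    (Gamma s)⁻¹ = s * (Gamma (s + 1))⁻¹ := by
  rcases eq_or_ne s 0 with rfl | hs
  · simp
  · rw [Gamma_add_one hs, mul_inv, mul_inv_cancel_left₀ hs]

lemma modLommel_eq_rpow_mul_tsum (μ ν : ℝ) {x : ℝ} (hx : 0 < x) :
    modLommel μ ν x = (x / 2) ^ (μ + 1) * ∑' k : ℕ, ((x / 2) ^ 2) ^ k *
      (Gamma (k + (μ - ν + 3) / 2))⁻¹ * (Gamma (k + (μ + ν + 3) / 2))⁻¹ := by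
  rw [modLommel, ← tsum_mul_left]
  refine tsum_congr fun k => ?_
  have hx2 : 0 < x / 2 := by positivity
  have hpow : (x / 2) ^ (μ + 2 * (k : ℝ) + 1) = (x / 2) ^ (μ + 1) * ((x / 2) ^ 2) ^ k := by
    rw [show μ + 2 * (k : ℝ) + 1 = (μ + 1) + (2 * k : ℕ) by push_cast; ring,
      rpow_add hx2, rpow_natCast, pow_mul]
  rw [hpow, div_eq_mul_inv, mul_inv]
  ring

theorem stmt_14 (μ ν : ℝ) (hμ : μ > -3) (hν : |ν| < μ + 3) :
    ∀ x : ℝ, 0 < x →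
      0 < 2 * (x / 2) ^ (2 * μ + 2) /
          ((μ + ν + 3) * (Gamma ((μ - ν + 3) / 2) * Gamma ((μ + ν + 3) / 2)) ^ 2) ∧
      2 * (x / 2) ^ (2 * μ + 2) /
          ((μ + ν + 3) * (Gamma ((μ - ν + 3) / 2) * Gamma ((μ + ν + 3) / 2)) ^ 2) ≤
        (modLommel μ ν x) ^ 2 - modLommel (μ - 1) (ν - 1) x * modLommel (μ + 1) (ν + 1) x ∧
      (modLommel μ ν x) ^ 2 - modLommel (μ - 1) (ν - 1) x * modLommel (μ + 1) (ν + 1) x ≤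
        2 * (modLommel μ ν x) ^ 2 / (μ + ν + 3) := by
  intro x hx
  obtain ⟨hν₁, hν₂⟩ := abs_lt.mp hν
  obtain ⟨a, ha⟩ : ∃ a, a = (μ - ν + 3) / 2 := ⟨_, rfl⟩
  obtain ⟨b, hb⟩ : ∃ b, b = (μ + ν + 3) / 2 := ⟨_, rfl⟩
  have ha0 : 0 < a := by linarith
  have hb0 : 0 < b := by linarith
  have hx2 : 0 < x / 2 := by positivity
  have hΓa : 0 < Gamma a := Gamma_pos_of_pos ha0
  have hΓb : 0 < Gamma b := Gamma_pos_of_pos hb0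
  have hinv_pos {c : ℝ} (hc : 0 < c) (k : ℕ) : 0 < (Gamma (k + c))⁻¹ :=
    inv_pos.mpr (Gamma_pos_of_pos (by positivity))
  have hinv_rec (c : ℝ) (k : ℕ) :
      (Gamma (k + c))⁻¹ = (k + c) * (Gamma ((k + 1 : ℕ) + c))⁻¹ := by
    rw [inv_Gamma_eq_mul_inv_Gamma_add_one]
    push_cast
    ring_nf
  obtain ⟨hlower, hupper⟩ := turan_bounds (z := (x / 2) ^ 2) ha0 hb0 (by positivity)
    (hinv_pos ha0) (hinv_pos hb0) (hinv_rec a) (hinv_rec b)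
  have hmid := modLommel_eq_rpow_mul_tsum μ ν hx
  rw [← ha, ← hb] at hmid
  have hdown : modLommel (μ - 1) (ν - 1) x = (x / 2) ^ μ * ∑' k : ℕ, (k + b - 1) *
      (((x / 2) ^ 2) ^ k * (Gamma (k + a))⁻¹ * (Gamma (k + b))⁻¹) := by
    rw [modLommel_eq_rpow_mul_tsum _ _ hx, sub_add_cancel]
    congr 1
    refine tsum_congr fun k => ?_
    rw [show (k : ℝ) + (μ - 1 - (ν - 1) + 3) / 2 = k + a by rw [ha]; ring,
      show (k : ℝ) + (μ - 1 + (ν - 1) + 3) / 2 = k + b - 1 by rw [hb]; ring,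
      inv_Gamma_eq_mul_inv_Gamma_add_one (k + b - 1), sub_add_cancel]
    ring
  have hup : modLommel (μ + 1) (ν + 1) x = (x / 2) ^ (μ + 2) * ∑' k : ℕ,
      (((x / 2) ^ 2) ^ k * (Gamma (k + a))⁻¹ * (Gamma (k + b))⁻¹) / (k + b) := by
    rw [modLommel_eq_rpow_mul_tsum _ _ hx, show μ + 1 + 1 = μ + 2 by ring]
    congr 1
    refine tsum_congr fun k => ?_
    have hkb : (0 : ℝ) < k + b := by positivity
    rw [show (k : ℝ) + (μ + 1 - (ν + 1) + 3) / 2 = k + a by rw [ha]; ring,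
      show (k : ℝ) + (μ + 1 + (ν + 1) + 3) / 2 = k + b + 1 by rw [hb]; ring,
      inv_Gamma_eq_mul_inv_Gamma_add_one (k + b)]
    field_simp
  have hpow_sq : ((x / 2) ^ (μ + 1)) ^ 2 = (x / 2) ^ (2 * μ + 2) := by
    rw [sq, ← rpow_add hx2]
    ring_nf
  have hpow_mul : (x / 2) ^ μ * (x / 2) ^ (μ + 2) = (x / 2) ^ (2 * μ + 2) := by
    rw [← rpow_add hx2]
    ring_nf
  have hpow_pos : 0 < (x / 2) ^ (2 * μ + 2) := rpow_pos_of_pos hx2 _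
  rw [← ha, ← hb, show μ + ν + 3 = 2 * b by linarith, hmid, hdown, hup,
    mul_pow ((x / 2) ^ (μ + 1)), mul_mul_mul_comm ((x / 2) ^ μ), hpow_sq, hpow_mul, ← mul_sub]
  refine ⟨by positivity, ?_, ?_⟩
  · refine le_trans (le_of_eq ?_) (mul_le_mul_of_nonneg_left hlower hpow_pos.le)
    simp only [CharP.cast_eq_zero, zero_add]
    field_simp
  · refine (mul_le_mul_of_nonneg_left hupper hpow_pos.le).trans (le_of_eq ?_)
    field_simp
end

section
/- Let μ, ν be real with μ > −1 and |μ| > |ν|. Then for all x > 0, t̃_{μ,ν}(x) < (Γ(μ+1) √(3(2μ+3)) / (2 Γ((μ−ν+3)/2) Γ((μ+ν+3)/2))) · x I_μ(x) / √(x² + 3(2μ+3)). -/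
open Real

/-- Modified Bessel function of the first kind. -/
noncomputable def modBessel (ν x : ℝ) : ℝ :=
  ∑' k : ℕ, (x / 2) ^ (2 * (k : ℝ) + ν) /
    ((Nat.factorial k : ℝ) * Gamma ((k : ℝ) + ν + 1))

open Filter Topology Set

section PowerSeries

variable {a : ℕ → ℝ}

lemma summable_natCast_mul_of_entire (ha : ∀ y : ℝ, Summable fun k => a k * y ^ k) (y : ℝ) :
    Summable fun k : ℕ => ((k : ℝ) * a k) * y ^ k := by
  refine .of_norm_bounded (ha (2 * y)).norm fun k => ?_
  have h : (k : ℝ) ≤ 2 ^ k := by exact_mod_cast Nat.lt_two_pow_self.le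
  rw [mul_assoc, mul_pow, mul_left_comm (a k), norm_mul, norm_mul _ (a k * y ^ k)]
  gcongr
  simpa using h

lemma hasDerivAt_tsum_of_entire (ha : ∀ y : ℝ, Summable fun k => a k * y ^ k) (y : ℝ) :
    HasDerivAt (fun z => ∑' k, a k * z ^ k) (∑' k, a k * ((k : ℝ) * y ^ (k - 1))) y := by
  set r : ℝ := |y| + 1
  have hr : 1 ≤ r := by simp [r]
  refine hasDerivAt_tsum_of_isPreconnected
    (u := fun k : ℕ => ‖((k : ℝ) * a k) * r ^ k‖) (t := Metric.ball 0 r) (y₀ := 0)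
    (summable_natCast_mul_of_entire ha r).norm Metric.isOpen_ball
    (convex_ball 0 r).isPreconnected (fun k z _ => (hasDerivAt_pow k z).const_mul (a k))
    (fun k z hz => ?_) (by simp; positivity) (ha 0) (by simp [r])
  have hz' : |z| ≤ r := by simpa using (mem_ball_zero_iff.1 hz).le
  have hpow : |z| ^ (k - 1) ≤ r ^ k :=
    (pow_le_pow_left₀ (abs_nonneg z) hz' _).trans (pow_le_pow_right₀ hr (Nat.sub_le k 1))
  simp only [norm_mul, norm_pow, Real.norm_eq_abs, abs_of_pos (zero_lt_one.trans_le hr)]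
  calc |a k| * (|(k : ℝ)| * |z| ^ (k - 1)) ≤ |a k| * (|(k : ℝ)| * r ^ k) := by gcongr
    _ = _ := by ring

lemma hasDerivAt_tsum_of_entire_of_ne_zero (ha : ∀ y : ℝ, Summable fun k => a k * y ^ k)
    {y : ℝ} (hy : y ≠ 0) :
    HasDerivAt (fun z => ∑' k, a k * z ^ k) ((∑' k : ℕ, ((k : ℝ) * a k) * y ^ k) / y) y := by
  convert hasDerivAt_tsum_of_entire ha y using 1
  rw [div_eq_iff hy, ← tsum_mul_right]
  refine tsum_congr fun k => ?_
  cases k with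
  | zero => simp
  | succ k => simp only [Nat.add_sub_cancel]; ring

lemma hasDerivAt_tsum_of_entire_zero (ha : ∀ y : ℝ, Summable fun k => a k * y ^ k) :
    HasDerivAt (fun z => ∑' k, a k * z ^ k) (a 1) 0 := by
  convert hasDerivAt_tsum_of_entire ha 0 using 1
  rw [tsum_eq_single 1]
  · simp
  · rintro (_ | _ | k) hk <;> simp_all

end PowerSeries

section Coefficients

/-- The coefficients `1 / ((a)ₖ (b)ₖ)`. -/
noncomputable def invPoch (a b : ℝ) (k : ℕ) : ℝ :=
  ∏ j ∈ Finset.range k, ((a + j) * (b + j))⁻¹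

/-- The entire function `∑ yᵏ / ((a)ₖ (b)ₖ)`. -/
noncomputable def pochSeries (a b y : ℝ) : ℝ := ∑' k, invPoch a b k * y ^ k

/-- The Euler derivative `y · d/dy` of `pochSeries a b`. -/
noncomputable def pochEuler (a b y : ℝ) : ℝ := ∑' k : ℕ, ((k : ℝ) * invPoch a b k) * y ^ k

variable {a b : ℝ}

@[simp] lemma invPoch_zero : invPoch a b 0 = 1 := by simp [invPoch]

lemma invPoch_succ (k : ℕ) :
    invPoch a b (k + 1) = invPoch a b k * ((a + k) * (b + k))⁻¹ :=
  Finset.prod_range_succ _ _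

lemma invPoch_pos (ha : 0 < a) (hb : 0 < b) (k : ℕ) : 0 < invPoch a b k :=
  Finset.prod_pos fun _ _ => by positivity

lemma mul_invPoch_succ (ha : 0 < a) (hb : 0 < b) (k : ℕ) :
    (a + k) * (b + k) * invPoch a b (k + 1) = invPoch a b k := by
  rw [invPoch_succ]
  field_simp

lemma summable_invPoch (ha : 0 < a) (hb : 0 < b) (y : ℝ) :
    Summable fun k => invPoch a b k * y ^ k := by
  rcases eq_or_ne y 0 with rfl | hy
  · exact summable_of_ne_finset_zero (s := {0}) fun k hk => by simp_all
  refine summable_of_ratio_test_tendsto_lt_one (l := 0) zero_lt_one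
    (.of_forall fun k => mul_ne_zero (invPoch_pos ha hb k).ne' (pow_ne_zero k hy)) ?_
  have hlim : ∀ c : ℝ, Tendsto (fun k : ℕ => c + k) atTop atTop := fun c =>
    tendsto_atTop_add_const_left _ c tendsto_natCast_atTop_atTop
  refine (((hlim a).atTop_mul_atTop₀ (hlim b)).const_div_atTop |y|).congr fun k => ?_
  have hc := invPoch_pos ha hb k
  have hy' : 0 < |y| := abs_pos.2 hy
  rw [invPoch_succ]
  simp only [norm_mul, norm_inv, norm_pow, Real.norm_eq_abs, abs_of_pos hc,
    abs_of_pos (show 0 < a + k by positivity), abs_of_pos (show 0 < b + k by positivity)]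
  field_simp
  ring

lemma summable_natCast_mul_invPoch (ha : 0 < a) (hb : 0 < b) (y : ℝ) :
    Summable fun k : ℕ => ((k : ℝ) * invPoch a b k) * y ^ k :=
  summable_natCast_mul_of_entire (summable_invPoch ha hb) y

lemma hasDerivAt_pochSeries (ha : 0 < a) (hb : 0 < b) {y : ℝ} (hy : y ≠ 0) :
    HasDerivAt (pochSeries a b) (pochEuler a b y / y) y :=
  hasDerivAt_tsum_of_entire_of_ne_zero (summable_invPoch ha hb) hy

lemma hasDerivAt_pochSeries_zero (ha : 0 < a) (hb : 0 < b) :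
    HasDerivAt (pochSeries a b) (a * b)⁻¹ 0 := by
  refine (hasDerivAt_tsum_of_entire_zero (summable_invPoch ha hb)).congr_deriv ?_
  simp [invPoch]

lemma continuous_pochSeries (ha : 0 < a) (hb : 0 < b) : Continuous (pochSeries a b) :=
  continuous_iff_continuousAt.2 fun y =>
    (hasDerivAt_tsum_of_entire (summable_invPoch ha hb) y).continuousAt

lemma continuous_pochEuler (ha : 0 < a) (hb : 0 < b) : Continuous (pochEuler a b) :=
  continuous_iff_continuousAt.2 fun y =>
    (hasDerivAt_tsum_of_entire (summable_natCast_mul_invPoch ha hb) y).continuousAt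

/-- The second-order equation `(θ + a - 1) (θ + b - 1) S = y S + (a - 1) (b - 1)`, `θ = y d/dy`. -/
lemma hasDerivAt_pochEuler (ha : 0 < a) (hb : 0 < b) {y : ℝ} (hy : y ≠ 0) :
    HasDerivAt (pochEuler a b)
      ((y * pochSeries a b y + (a - 1) * (b - 1) - (a + b - 2) * pochEuler a b y
        - (a - 1) * (b - 1) * pochSeries a b y) / y) y := by
  have hS := summable_invPoch ha hb y
  have hT := summable_natCast_mul_invPoch ha hb y
  have hU := summable_natCast_mul_of_entire (summable_natCast_mul_invPoch ha hb) y
  refine (hasDerivAt_tsum_of_entire_of_ne_zero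
    (summable_natCast_mul_invPoch ha hb) hy).congr_deriv (congrArg (· / y) ?_)
  have hsum : HasSum (fun k : ℕ => (k : ℝ) * (k * invPoch a b k) * y ^ k
      + (a + b - 2) * (k * invPoch a b k * y ^ k) + (a - 1) * (b - 1) * (invPoch a b k * y ^ k))
      (∑' k : ℕ, (k : ℝ) * (k * invPoch a b k) * y ^ k + (a + b - 2) * pochEuler a b y
        + (a - 1) * (b - 1) * pochSeries a b y) :=
    (hU.hasSum.add (hT.hasSum.mul_left (a + b - 2))).add (hS.hasSum.mul_left ((a - 1) * (b - 1)))
  have hshift : HasSum (fun k => y * (invPoch a b k * y ^ k)) (y * pochSeries a b y) :=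
    hS.hasSum.mul_left y
  have heq := ((hasSum_nat_add_iff' 1).2 hsum).unique (hshift.congr_fun fun k => by
    rw [← mul_invPoch_succ ha hb k]
    push_cast
    ring)
  simp only [Finset.range_one, Finset.sum_singleton, invPoch_zero, Nat.cast_zero, pow_zero] at heq
  linarith

lemma pochSeries_zero : pochSeries a b 0 = 1 := by
  rw [pochSeries, tsum_eq_single 0] <;> simp_all

lemma quadratic_le_pochSeries (ha : 0 < a) (hb : 0 < b) {y : ℝ} (hy : 0 ≤ y) :
    1 + y / (a * b) + y ^ 2 / (a * b * ((a + 1) * (b + 1))) ≤ pochSeries a b y := by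
  have h := (summable_invPoch ha hb y).sum_le_tsum (Finset.range 3)
    fun k _ => mul_nonneg (invPoch_pos ha hb k).le (pow_nonneg hy k)
  refine le_trans (le_of_eq ?_) h
  simp [Finset.sum_range_succ, invPoch, Finset.prod_range_succ]
  field_simp

lemma linear_le_pochEuler (ha : 0 < a) (hb : 0 < b) {y : ℝ} (hy : 0 ≤ y) :
    y / (a * b) ≤ pochEuler a b y := by
  have h := (summable_natCast_mul_invPoch ha hb y).sum_le_tsum (Finset.range 2)
    fun k _ => mul_nonneg (mul_nonneg k.cast_nonneg (invPoch_pos ha hb k).le) (pow_nonneg hy k)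
  refine le_trans (le_of_eq ?_) h
  simp [Finset.sum_range_succ, invPoch]
  field_simp

lemma pochSeries_le_one_add_pochEuler (ha : 0 < a) (hb : 0 < b) {y : ℝ} (hy : 0 ≤ y) :
    pochSeries a b y ≤ 1 + pochEuler a b y := by
  have hT := summable_natCast_mul_invPoch ha hb y
  rw [pochSeries, pochEuler, (summable_invPoch ha hb y).tsum_eq_zero_add,
    hT.tsum_eq_zero_add]
  simp only [invPoch_zero, pow_zero, mul_one, Nat.cast_zero, zero_add]
  refine add_le_add_right ?_ 1
  refine ((summable_nat_add_iff 1).2 (summable_invPoch ha hb y)).tsum_le_tsum (fun k => ?_)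
    ((summable_nat_add_iff 1).2 hT)
  have := invPoch_pos ha hb (k + 1)
  gcongr
  push_cast
  nlinarith [k.cast_nonneg (α := ℝ)]

/-- With a fixed sum of parameters, `pochSeries` is strictly decreasing in their product. -/
lemma pochSeries_lt_pochSeries {a' b' y : ℝ} (ha : 0 < a) (hb : 0 < b) (ha' : 0 < a')
    (hb' : 0 < b') (hadd : a + b = a' + b') (hmul : a' * b' < a * b) (hy : 0 < y) :
    pochSeries a b y < pochSeries a' b' y := by
  have hle : ∀ k, invPoch a b k ≤ invPoch a' b' k := fun k =>
    Finset.prod_le_prod (fun _ _ => by positivity) fun j _ => by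
      gcongr ?_⁻¹
      nlinarith
  refine Summable.tsum_lt_tsum (i := 1) (fun k => by gcongr; exact hle k) ?_
    (summable_invPoch ha hb y) (summable_invPoch ha' hb' y)
  simp only [invPoch, Finset.prod_range_one, Nat.cast_zero, add_zero, pow_one]
  gcongr

end Coefficients

section Comparison

lemma eventually_pos_of_hasDerivAt_zero {f : ℝ → ℝ} {d : ℝ} (hf : HasDerivAt f d 0)
    (h0 : f 0 = 0) (hd : 0 < d) : ∀ᶠ y in 𝓝[>] 0, 0 < f y := by
  have h := (hasDerivAt_iff_tendsto_slope.1 hf).eventually (lt_mem_nhds hd)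
  filter_upwards [h.filter_mono (nhdsWithin_mono (0 : ℝ) fun y (hy : 0 < y) => hy.ne'),
    self_mem_nhdsWithin] with y hy hy0
  rw [slope_def_field, h0, sub_zero, sub_zero] at hy
  exact (div_pos_iff_of_pos_right hy0).1 hy

lemma hasDerivAt_rpow_mul {f : ℝ → ℝ} {α g y : ℝ} (hy : 0 < y)
    (hf : HasDerivAt f ((g - α * f y) / y) y) :
    HasDerivAt (fun z => z ^ α * f z) (y ^ α * g / y) y := by
  refine ((Real.hasDerivAt_rpow_const (p := α) (Or.inl hy.ne')).mul hf).congr_deriv ?_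
  rw [Real.rpow_sub_one hy.ne']
  field_simp
  ring

/-- Positivity for `(θ + α) (θ + β) D = y D + R` with `R ≥ 0`, where `E = (θ + β) D` and
`θ = y d/dy`. -/
lemma pos_of_euler_system {D E R : ℝ → ℝ} {α β : ℝ} (hα : 0 < α)
    (hD : ∀ y, 0 < y → HasDerivAt D ((E y - β * D y) / y) y)
    (hE : ∀ y, 0 < y → HasDerivAt E ((y * D y + R y - α * E y) / y) y)
    (hE0 : ContinuousWithinAt E (Ici 0) 0) (hR : ∀ y, 0 < y → 0 ≤ R y)
    (hpos : ∀ᶠ y in 𝓝[>] 0, 0 < D y) {y : ℝ} (hy : 0 < y) : 0 < D y := by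
  by_contra! hneg
  obtain ⟨δ, hδ, hδpos⟩ := mem_nhdsGT_iff_exists_Ioo_subset.1 hpos
  have hδ : 0 < δ := hδ
  have hδy : δ ≤ y := by
    by_contra! h
    exact absurd (hδpos ⟨hy, h⟩) (not_lt.2 hneg)
  have hcD : ∀ s ⊆ Ioi (0 : ℝ), ContinuousOn D s := fun s hs z hz =>
    (hD z (hs hz)).continuousAt.continuousWithinAt
  have hcompact : IsCompact (Icc δ y ∩ D ⁻¹' Iic 0) :=
    isCompact_Icc.of_isClosed_subset
      ((hcD _ fun z hz => hδ.trans_le hz.1).preimage_isClosed_of_isClosed isClosed_Icc isClosed_Iic)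
      inter_subset_left
  obtain ⟨y₀, ⟨hy₀, hDy₀⟩, hleast⟩ := hcompact.exists_isLeast ⟨y, ⟨hδy, le_rfl⟩, hneg⟩
  have hy₀pos : 0 < y₀ := hδ.trans_le hy₀.1
  have hDpos : ∀ z ∈ Ioo 0 y₀, 0 < D z := fun z hz => by
    by_contra! h
    rcases lt_or_ge z δ with hzδ | hzδ
    · exact absurd (hδpos ⟨hz.1, hzδ⟩) (not_lt.2 h)
    · exact absurd (hleast ⟨⟨hzδ, hz.2.le.trans hy₀.2⟩, h⟩) (not_le.2 hz.2)
  have hdE := fun z (hz : 0 < z) => hasDerivAt_rpow_mul hz (hE z hz)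
  have hmonoE : MonotoneOn (fun z => z ^ α * E z) (Icc 0 y₀) := by
    refine monotoneOn_of_deriv_nonneg (convex_Icc _ _) (fun z hz => ?_) ?_ ?_
    · rcases hz.1.eq_or_lt with rfl | hz0
      · exact (((Real.continuousAt_rpow_const 0 α (Or.inr hα.le)).continuousWithinAt).mul
          hE0).mono Icc_subset_Ici_self
      · exact (hdE z hz0).continuousAt.continuousWithinAt
    · rw [interior_Icc]
      exact fun z hz => (hdE z hz.1).differentiableAt.differentiableWithinAt
    · rw [interior_Icc]
      intro z hz
      rw [(hdE z hz.1).deriv]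
      have := hDpos z hz
      have := hR z hz.1
      have := hz.1
      positivity
  have hEnonneg : ∀ z ∈ Ioo 0 y₀, 0 ≤ E z := fun z hz => by
    have h := hmonoE ⟨le_rfl, hy₀pos.le⟩ ⟨hz.1.le, hz.2.le⟩ hz.1.le
    simp only [Real.zero_rpow hα.ne', zero_mul] at h
    exact nonneg_of_mul_nonneg_right h (Real.rpow_pos_of_pos hz.1 α)
  have hdD := fun z (hz : 0 < z) => hasDerivAt_rpow_mul hz (hD z hz)
  have hmonoD : MonotoneOn (fun z => z ^ β * D z) (Icc (y₀ / 2) y₀) := by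
    have hpos' : ∀ z, y₀ / 2 ≤ z → 0 < z := fun z hz => (half_pos hy₀pos).trans_le hz
    refine monotoneOn_of_deriv_nonneg (convex_Icc _ _)
      (fun z hz => (hdD z (hpos' z hz.1)).continuousAt.continuousWithinAt) ?_ ?_
    · rw [interior_Icc]
      exact fun z hz => (hdD z (hpos' z hz.1.le)).differentiableAt.differentiableWithinAt
    · rw [interior_Icc]
      intro z hz
      have hz0 := hpos' z hz.1.le
      rw [(hdD z hz0).deriv]
      have := hEnonneg z ⟨hz0, hz.2⟩
      positivity
  have hhalf : y₀ / 2 < y₀ := half_lt_self hy₀pos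
  have h := hmonoD ⟨le_rfl, hhalf.le⟩ ⟨hhalf.le, le_rfl⟩ hhalf.le
  have h1 : 0 < (y₀ / 2) ^ β * D (y₀ / 2) :=
    mul_pos (Real.rpow_pos_of_pos (half_pos hy₀pos) β) (hDpos _ ⟨half_pos hy₀pos, hhalf⟩)
  have h2 : y₀ ^ β * D y₀ ≤ 0 :=
    mul_nonpos_of_nonneg_of_nonpos (Real.rpow_nonneg hy₀pos.le β) hDy₀
  exact absurd (h1.trans_le h) (not_lt.2 h2)

end Comparison

section Bessel

variable {μ y : ℝ}

lemma mul_rpow_three_halves_le (hμ : -1 < μ) (hy : 0 < y) {q : ℝ}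
    (hq : q = 1 + 4 * y / (3 * (2 * μ + 3))) :
    (μ / 2 + 1 / 4) * (q * √q) ≤
      pochEuler 1 (μ + 1) y + (μ / 2 + 1 / 4 - 3 / 4 * (1 - q⁻¹)) * pochSeries 1 (μ + 1) y := by
  have hb : 0 < μ + 1 := by linarith
  have hc : 0 < 2 * μ + 3 := by linarith
  obtain ⟨s, hs⟩ : ∃ s, s = 4 * y / (3 * (2 * μ + 3)) := ⟨_, rfl⟩
  have hspos : 0 < s := by rw [hs]; positivity
  have hys : y = 3 / 4 * (2 * μ + 3) * s := by rw [hs]; field_simp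
  rw [← hs] at hq
  have hqpos : 0 < q := by linarith
  have hquad := quadratic_le_pochSeries one_pos hb hy.le
  have hlin := linear_le_pochEuler one_pos hb hy.le
  have hle := pochSeries_le_one_add_pochEuler one_pos hb hy.le
  set G := pochSeries 1 (μ + 1) y
  set T := pochEuler 1 (μ + 1) y
  have hy1 : 3 / 2 * s ≤ y / (1 * (μ + 1)) := by
    rw [le_div_iff₀ (by positivity), hys]
    nlinarith
  have hy2 : 9 / 8 * s ^ 2 ≤ y ^ 2 / (1 * (μ + 1) * ((1 + 1) * (μ + 1 + 1))) := by
    rw [le_div_iff₀ (by positivity), hys]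
    nlinarith [sq_nonneg s]
  have hG : 1 + 3 / 2 * s + 9 / 8 * s ^ 2 ≤ G := by linarith
  have hσ : (1 - q⁻¹) * G ≤ T := by
    have : (q - 1) * G ≤ q * T := by rw [hq]; nlinarith
    rw [show 1 - q⁻¹ = (q - 1) / q by field_simp, div_mul_eq_mul_div, div_le_iff₀ hqpos]
    linarith
  have hTpos : 0 < T := by linarith
  have hσ' : 3 / 4 * (1 - q⁻¹) * G ≤ 3 / 4 * T := by linarith
  rcases le_total 0 (μ / 2 + 1 / 4) with ha | ha
  · have hw : q * √q ≤ G := by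
      refine le_trans (abs_le_of_sq_le_sq' ?_ ?_).2 hG
      · rw [mul_pow, Real.sq_sqrt hqpos.le, hq]
        nlinarith [pow_pos hspos 2, pow_pos hspos 3, pow_pos hspos 4]
      · positivity
    nlinarith [mul_le_mul_of_nonneg_left hw ha]
  · have hw : 1 ≤ q * √q := by
      have h1 : 1 ≤ q := by linarith
      exact one_le_mul_of_one_le_of_one_le h1 (Real.one_le_sqrt.2 h1)
    nlinarith [mul_le_mul_of_nonpos_left hw ha, mul_le_mul_of_nonpos_left hle ha]

/-- The bound in the extremal case `ν = μ`, where the Lommel function is a Struve function. -/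
lemma pochSeries_three_halves_lt (hμ : -1 < μ) (hy : 0 < y) :
    pochSeries (3 / 2) (μ + 3 / 2) y <
      (√(1 + 4 * y / (3 * (2 * μ + 3))))⁻¹ * pochSeries 1 (μ + 1) y := by
  have h32 : (0 : ℝ) < 3 / 2 := by norm_num
  have hb : 0 < μ + 1 := by linarith
  have hb' : 0 < μ + 3 / 2 := by linarith
  have hc : 0 < 2 * μ + 3 := by linarith
  set q : ℝ → ℝ := fun z => 1 + 4 * z / (3 * (2 * μ + 3)) with hq
  have hqpos : ∀ z, 0 ≤ z → 0 < q z := fun z hz => by simp only [hq]; positivity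
  have hdq : ∀ z, HasDerivAt q (4 / (3 * (2 * μ + 3))) z := fun z => by
    refine ((((hasDerivAt_id z).const_mul 4).div_const (3 * (2 * μ + 3))).const_add 1).congr_deriv ?_
    rw [mul_one]
  have hcq : Continuous q := continuous_iff_continuousAt.2 fun z => (hdq z).continuousAt
  have hslope : ∀ z, 0 < z → 4 / (3 * (2 * μ + 3)) = (q z - 1) / z := fun z hz => by
    simp only [hq]
    field_simp
    ring
  have hdr : ∀ z, 0 < z →
      HasDerivAt (fun z => (q z)⁻¹) (-((q z)⁻¹ * (1 - (q z)⁻¹)) / z) z := fun z hz => by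
    have := hqpos z hz.le
    refine ((hdq z).inv this.ne').congr_deriv ?_
    rw [hslope z hz]
    field_simp
  have hdm0 : ∀ z, 0 ≤ z → HasDerivAt (fun z => (√(q z))⁻¹)
      (-(1 / 2) * (√(q z))⁻¹ * (q z)⁻¹ * (4 / (3 * (2 * μ + 3)))) z := fun z hz => by
    have h := hqpos z hz
    have h' : 0 < √(q z) := Real.sqrt_pos.2 h
    refine (((hdq z).sqrt h.ne').inv h'.ne').congr_deriv ?_
    rw [Real.sq_sqrt h.le]
    field_simp
  have hdm : ∀ z, 0 < z → HasDerivAt (fun z => (√(q z))⁻¹)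
      (-(1 / 2) * (√(q z))⁻¹ * (1 - (q z)⁻¹) / z) z := fun z hz => by
    have := hqpos z hz.le
    refine (hdm0 z hz.le).congr_deriv ?_
    rw [hslope z hz]
    field_simp
  set G := pochSeries 1 (μ + 1)
  set GT := pochEuler 1 (μ + 1)
  set F := pochSeries (3 / 2) (μ + 3 / 2)
  set FT := pochEuler (3 / 2) (μ + 3 / 2)
  rw [← sub_pos]
  refine pos_of_euler_system (D := fun z => (√(q z))⁻¹ * G z - F z)
    (E := fun z => (√(q z))⁻¹ * (GT z + (μ + 1 / 2 - 1 / 2 * (1 - (q z)⁻¹)) * G z)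
      - (FT z + (μ + 1 / 2) * F z))
    (R := fun z => (√(q z))⁻¹ * (q z)⁻¹ *
      (GT z + (μ / 2 + 1 / 4 - 3 / 4 * (1 - (q z)⁻¹)) * G z) - (μ / 2 + 1 / 4))
    (α := 1 / 2) (β := μ + 1 / 2) (by norm_num) (fun z hz => ?_) (fun z hz => ?_) ?_
    (fun z hz => ?_) ?_ hy
  · refine (((hdm z hz).mul (hasDerivAt_pochSeries one_pos hb hz.ne')).sub
      (hasDerivAt_pochSeries h32 hb' hz.ne')).congr_deriv ?_
    simp only [G, GT, F, FT]
    ring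
  · have hdG := hasDerivAt_pochSeries one_pos hb hz.ne'
    have hdGT := hasDerivAt_pochEuler one_pos hb hz.ne'
    have hdF := hasDerivAt_pochSeries h32 hb' hz.ne'
    have hdFT := hasDerivAt_pochEuler h32 hb' hz.ne'
    refine (((hdm z hz).mul (hdGT.add (((((hdr z hz).const_sub 1).const_mul (1 / 2)).const_sub
      (μ + 1 / 2)).mul hdG))).sub (hdFT.add (hdF.const_mul (μ + 1 / 2)))).congr_deriv ?_
    simp only [G, GT, F, FT, Pi.add_apply, Pi.mul_apply]
    ring
  · have hq0 := hqpos 0 le_rfl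
    have hG : ContinuousAt G 0 := (continuous_pochSeries one_pos hb).continuousAt
    have hGT : ContinuousAt GT 0 := (continuous_pochEuler one_pos hb).continuousAt
    have hF : ContinuousAt F 0 := (continuous_pochSeries h32 hb').continuousAt
    have hFT : ContinuousAt FT 0 := (continuous_pochEuler h32 hb').continuousAt
    have hr : ContinuousAt (fun z => (q z)⁻¹) 0 := hcq.continuousAt.inv₀ hq0.ne'
    have hm : ContinuousAt (fun z => (√(q z))⁻¹) 0 := (hdm0 0 le_rfl).continuousAt
    exact (by fun_prop : ContinuousAt _ (0 : ℝ)).continuousWithinAt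
  · have h := hqpos z hz.le
    have h' : 0 < √(q z) := Real.sqrt_pos.2 h
    have hmain := mul_rpow_three_halves_le hμ hz (q := q z) rfl
    rw [sub_nonneg, ← mul_inv, inv_mul_eq_div, le_div_iff₀ (by positivity), mul_comm (√(q z))]
    exact hmain
  · have hq0 : q 0 = 1 := by simp [hq]
    refine eventually_pos_of_hasDerivAt_zero (((hdm0 0 le_rfl).mul
      (hasDerivAt_pochSeries_zero one_pos hb)).sub (hasDerivAt_pochSeries_zero h32 hb')) ?_ ?_
    · simp [hq0, G, F, pochSeries_zero]
    · rw [hq0, pochSeries_zero, sub_pos, Real.sqrt_one]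
      have h1 : -(1 / 2) * (1 : ℝ)⁻¹ * 1⁻¹ * (4 / (3 * (2 * μ + 3))) * 1 + 1⁻¹ * (1 * (μ + 1))⁻¹
          - (3 / 2 * (μ + 3 / 2))⁻¹ = 1 / ((μ + 1) * (2 * μ + 3)) := by
        rw [show μ + 3 / 2 = (2 * μ + 3) / 2 by ring]
        field_simp
        ring
      rw [← sub_pos, h1]
      positivity

end Bessel

section Gamma

lemma Gamma_natCast_add {a : ℝ} (ha : 0 < a) (k : ℕ) :
    Gamma (k + a) = Gamma a * ∏ j ∈ Finset.range k, (a + j) := by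
  induction k with
  | zero => simp
  | succ k ih =>
    rw [Finset.prod_range_succ, ← mul_assoc, ← ih, Nat.cast_succ, add_right_comm,
      Gamma_add_one (by positivity)]
    ring

lemma inv_Gamma_mul_Gamma_natCast_add {a b : ℝ} (ha : 0 < a) (hb : 0 < b) (k : ℕ) :
    (Gamma (k + a) * Gamma (k + b))⁻¹ = (Gamma a * Gamma b)⁻¹ * invPoch a b k := by
  rw [Gamma_natCast_add ha, Gamma_natCast_add hb, invPoch, Finset.prod_inv_distrib,
    Finset.prod_mul_distrib, ← mul_inv]
  ring_nf

lemma rpow_add_two_mul_natCast {x : ℝ} (hx : 0 < x) (s : ℝ) (k : ℕ) :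
    (x / 2) ^ (s + 2 * (k : ℝ)) = (x / 2) ^ s * (x ^ 2 / 4) ^ k := by
  rw [Real.rpow_add (by positivity), Real.rpow_mul (by positivity), Real.rpow_natCast,
    Real.rpow_two]
  ring_nf

lemma modLommel_eq {μ ν x : ℝ} (ha : 0 < (μ - ν + 3) / 2) (hb : 0 < (μ + ν + 3) / 2)
    (hx : 0 < x) :
    modLommel μ ν x = (x / 2) ^ (μ + 1) * (Gamma ((μ - ν + 3) / 2) * Gamma ((μ + ν + 3) / 2))⁻¹ *
      pochSeries ((μ - ν + 3) / 2) ((μ + ν + 3) / 2) (x ^ 2 / 4) := by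
  rw [modLommel, pochSeries, ← tsum_mul_left]
  refine tsum_congr fun k => ?_
  rw [div_eq_mul_inv, inv_Gamma_mul_Gamma_natCast_add ha hb, add_right_comm,
    rpow_add_two_mul_natCast hx]
  ring

lemma modBessel_eq {μ x : ℝ} (hμ : 0 < μ + 1) (hx : 0 < x) :
    modBessel μ x = (x / 2) ^ μ * (Gamma (μ + 1))⁻¹ * pochSeries 1 (μ + 1) (x ^ 2 / 4) := by
  rw [modBessel, pochSeries, ← tsum_mul_left]
  refine tsum_congr fun k => ?_
  rw [div_eq_mul_inv, ← Gamma_nat_eq_factorial, add_assoc (k : ℝ) μ,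
    inv_Gamma_mul_Gamma_natCast_add one_pos hμ, Gamma_one, one_mul, add_comm _ μ,
    rpow_add_two_mul_natCast hx]
  ring

end Gamma

theorem stmt_19 (μ ν : ℝ) (hμ : μ > -1) (hν : |μ| > |ν|) :
    ∀ x : ℝ, 0 < x →
      modLommel μ ν x <
        Gamma (μ + 1) * Real.sqrt (3 * (2 * μ + 3)) /
            (2 * Gamma ((μ - ν + 3) / 2) * Gamma ((μ + ν + 3) / 2)) *
          (x * modBessel μ x / Real.sqrt (x ^ 2 + 3 * (2 * μ + 3))) := by
  intro x hx
  have hμν : |ν| < μ + 3 := hν.trans (abs_lt.2 ⟨by linarith, by linarith⟩)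
  have ha : 0 < (μ - ν + 3) / 2 := by linarith [(abs_lt.1 hμν).2]
  have hb : 0 < (μ + ν + 3) / 2 := by linarith [(abs_lt.1 hμν).1]
  have hμ1 : 0 < μ + 1 := by linarith
  have hc : 0 < 3 * (2 * μ + 3) := by linarith
  have hlt := (pochSeries_lt_pochSeries ha hb (a' := 3 / 2) (b' := μ + 3 / 2) (by norm_num)
    (by linarith) (by ring) (by nlinarith [sq_lt_sq.2 hν]) (by positivity : 0 < x ^ 2 / 4)).trans
    (pochSeries_three_halves_lt hμ (by positivity))
  have hsqrt : √(1 + 4 * (x ^ 2 / 4) / (3 * (2 * μ + 3))) =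
      √(x ^ 2 + 3 * (2 * μ + 3)) / √(3 * (2 * μ + 3)) := by
    rw [← Real.sqrt_div (by positivity)]
    rw [add_div, div_self hc.ne', mul_div_cancel₀ _ four_ne_zero, add_comm]
  rw [hsqrt, inv_div] at hlt
  have hΓ := Gamma_pos_of_pos hμ1
  have hΓa := Gamma_pos_of_pos ha
  have hΓb := Gamma_pos_of_pos hb
  rw [modLommel_eq ha hb hx, modBessel_eq hμ1 hx, Real.rpow_add_one (by positivity)]
  have hpre : 0 < (x / 2) ^ μ * (x / 2) *
      (Gamma ((μ - ν + 3) / 2) * Gamma ((μ + ν + 3) / 2))⁻¹ := by positivity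
  refine (mul_lt_mul_of_pos_left hlt hpre).trans_eq ?_
  field_simp
end
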